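/- arXiv:2204.08436 — 3 statements merged into one kernel-verified Lean document; each statement's English description precedes it below -/
import Mathlib

section
/- Every φ-metric space is metrizable: if (X, d_φ, φ) is a φ-metric space, then there exists a metric d on X whose induced metric topology coincides with τ_φ. -/
open Filter Topology Set

/-- A φ-metric on a set `X`: a pair of functions `d : X × X → ℝ≥0` and
`phi : X × X × X → ℝ≥0` satisfying the axioms (d1)–(d3) and (φ1)–(φ3). -/
structure PhiMetric (X : Type*) where
  d : X → X → ℝ
  phi : X → X → X → ℝ
  d_nonneg : ∀ x y, 0 ≤ d x y
  phi_nonneg : ∀ x y z, 0 ≤ phi x y z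
  /-- (d1) -/
  d_eq_zero_iff : ∀ x y, d x y = 0 ↔ x = y
  /-- (d2) -/
  d_symm : ∀ x y, d x y = d y x
  /-- (d3) -/
  d_triangle : ∀ x y z, d x y ≤ d x z + d z y + phi x y z
  /-- (φ1) -/
  phi_eq_zero : ∀ x y z, x = z ∨ y = z → phi x y z = 0
  /-- (φ2) -/
  phi_symm : ∀ x y z, phi x y z = phi y x z
  /-- (φ3) -/
  phi_small : ∀ ε : ℝ, 0 < ε → ∃ δ : ℝ, 0 < δ ∧
    ∀ x y z, (d x z < δ ∨ d y z < δ) → phi x y z < ε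

namespace PhiMetric

variable {X : Type*}

/-- The open ball `B_φ(x, r)`. -/
def ball (M : PhiMetric X) (x : X) (r : ℝ) : Set X := {y | M.d x y < r}

/-- The topology `τ_φ` generated by a φ-metric:
`G` is open iff every point of `G` has an open ball around it inside `G`. -/
def toTopology (M : PhiMetric X) : TopologicalSpace X where
  IsOpen G := ∀ x ∈ G, ∃ r > 0, M.ball x r ⊆ G
  isOpen_univ := fun x _ => ⟨1, one_pos, fun y _ => Set.mem_univ y⟩
  isOpen_inter := by
    intro s t hs ht x hx
    obtain ⟨r1, hr1, h1⟩ := hs x hx.1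
    obtain ⟨r2, hr2, h2⟩ := ht x hx.2
    refine ⟨min r1 r2, lt_min hr1 hr2, fun y hy => ⟨h1 ?_, h2 ?_⟩⟩
    · have hy' : M.d x y < min r1 r2 := hy
      exact lt_of_lt_of_le hy' (min_le_left _ _)
    · have hy' : M.d x y < min r1 r2 := hy
      exact lt_of_lt_of_le hy' (min_le_right _ _)
  isOpen_sUnion := by
    intro S hS x hx
    obtain ⟨s, hs, hxs⟩ := hx
    obtain ⟨r, hr, hb⟩ := hS s hs x hxs
    exact ⟨r, hr, fun y hy => ⟨s, hs, hb hy⟩⟩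

/-- A sequence is Cauchy with respect to a φ-metric. -/
def IsCauchySeq (M : PhiMetric X) (u : ℕ → X) : Prop :=
  ∀ ε : ℝ, 0 < ε → ∃ N : ℕ, ∀ m ≥ N, ∀ n ≥ N, M.d (u m) (u n) < ε

/-- A φ-metric space is complete if every Cauchy sequence converges. -/
def Complete (M : PhiMetric X) : Prop :=
  ∀ u : ℕ → X, M.IsCauchySeq u →
    ∃ a : X, Filter.Tendsto (fun n => M.d (u n) a) Filter.atTop (nhds 0)

end PhiMetric

namespace PhiMetric

variable {X : Type*} (M : PhiMetric X)

theorem hasBasis_comap_d :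
    (comap (fun p : X × X => M.d p.1 p.2) (𝓝 0)).HasBasis (fun ε : ℝ => 0 < ε)
      fun ε => {p | M.d p.1 p.2 < ε} := by
  refine (Metric.nhds_basis_ball.comap _).congr (fun _ => Iff.rfl) fun ε _ => ?_
  ext p
  simp [abs_of_nonneg (M.d_nonneg p.1 p.2)]

theorem exists_d_lt_of_d_lt {ε : ℝ} (hε : 0 < ε) :
    ∃ δ > 0, ∀ x y z, M.d x z < δ → M.d z y < δ → M.d x y < ε := by
  obtain ⟨δ, hδ, h⟩ := M.phi_small (ε / 3) (by positivity)
  refine ⟨min δ (ε / 3), by positivity, fun x y z hxz hzy => ?_⟩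
  rw [lt_min_iff] at hxz hzy
  linarith [M.d_triangle x y z, h x y z (Or.inl hxz.1)]

/-- The uniform structure generated by the entourages `{(x, y) | d x y < ε}`. -/
def uniformCore : UniformSpace.Core X where
  uniformity := comap (fun p : X × X => M.d p.1 p.2) (𝓝 0)
  refl := by
    refine M.hasBasis_comap_d.ge_iff.2 fun ε hε => ?_
    rintro ⟨x, y⟩ (rfl : x = y)
    simpa [(M.d_eq_zero_iff x x).2 rfl] using hε
  symm := by
    refine (M.hasBasis_comap_d.tendsto_iff M.hasBasis_comap_d).2 fun ε hε => ⟨ε, hε, ?_⟩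
    rintro ⟨x, y⟩ hxy
    exact (M.d_symm y x).trans_lt hxy
  comp := by
    refine ((M.hasBasis_comap_d.lift' (monotone_id.relComp monotone_id)).le_basis_iff
      M.hasBasis_comap_d).2 fun ε hε => ?_
    obtain ⟨δ, hδ, h⟩ := M.exists_d_lt_of_d_lt hε
    refine ⟨δ, hδ, ?_⟩
    rintro ⟨x, y⟩ ⟨z, hxz, hzy⟩
    exact h x y z hxz hzy

theorem toTopologicalSpace_uniformCore : (UniformSpace.ofCore M.uniformCore).toTopologicalSpace =
    M.toTopology := by
  ext G
  let := UniformSpace.ofCore M.uniformCore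
  refine isOpen_uniformity.trans (forall₂_congr fun x _ => ?_)
  refine M.hasBasis_comap_d.mem_iff.trans (exists_congr fun r => and_congr_right fun _ => ?_)
  constructor
  · exact fun h y hy => h (show (x, y) ∈ {p : X × X | M.d p.1 p.2 < r} from hy) rfl
  · rintro h ⟨_, y⟩ hy rfl
    exact h hy

end PhiMetric

/-- every φ-metric space is metrizable. -/
theorem phiMetric_metrizable {X : Type*} [Nonempty X] (M : PhiMetric X) :
    ∃ m : MetricSpace X, m.toUniformSpace.toTopologicalSpace = M.toTopology := by
  let : UniformSpace X := UniformSpace.ofCore M.uniformCore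
  have hb : (uniformity X).HasBasis (fun ε : ℝ => 0 < ε) fun ε => {p | M.d p.1 p.2 < ε} :=
    M.hasBasis_comap_d
  have : (uniformity X).IsCountablyGenerated :=
    inferInstanceAs (comap (fun p : X × X => M.d p.1 p.2) (𝓝 0)).IsCountablyGenerated
  have : T0Space X := t0Space_iff_uniformity.2 fun x y h =>
    (M.d_eq_zero_iff x y).1 <| le_antisymm
      (le_of_forall_pos_lt_add fun ε hε => by simpa using h _ (hb.mem_of_mem hε))
      (M.d_nonneg x y)
  exact ⟨UniformSpace.metricSpace X, M.toTopologicalSpace_uniformCore⟩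
end

section
/- Let (X, d_φ, φ) be a φ-metric space whose topology τ_φ is compact. Then X is complete: every Cauchy sequence in X converges to some point of X (with respect to d_φ). -/
open Filter Topology Set

namespace PhiMetric

/-- Open balls are open in the topology of a φ-metric. -/
theorem isOpen_ball {X : Type*} (M : PhiMetric X) (x : X) (r : ℝ) :
    IsOpen[M.toTopology] (M.ball x r) := by
  intro y hy
  have hy' : M.d x y < r := hy
  obtain ⟨δ, hδ, h⟩ := M.phi_small ((r - M.d x y) / 2) (by linarith)
  refine ⟨min δ ((r - M.d x y) / 2), lt_min hδ (by linarith), fun z hz => ?_⟩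
  obtain ⟨hzδ, hzr⟩ := lt_min_iff.mp (show M.d y z < min δ _ from hz)
  have hphi := h x z y (.inr (by rwa [M.d_symm]))
  change M.d x z < r
  linarith [M.d_triangle x z y]

/-- A Cauchy sequence with a cluster point converges to it. -/
theorem IsCauchySeq.tendsto_of_mapClusterPt {X : Type*} {M : PhiMetric X} {u : ℕ → X} {a : X}
    (hu : M.IsCauchySeq u) (ha : @MapClusterPt X M.toTopology ℕ a atTop u) :
    Tendsto (fun n => M.d (u n) a) atTop (𝓝 0) := by
  let _ := M.toTopology
  rw [Metric.tendsto_atTop]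
  intro ε hε
  obtain ⟨δ, hδ, h⟩ := M.phi_small (ε / 3) (by positivity)
  obtain ⟨N, hN⟩ := hu (ε / 3) (by positivity)
  have hr : 0 < min δ (ε / 3) := lt_min hδ (by positivity)
  have hball : M.ball a (min δ (ε / 3)) ∈ 𝓝 a :=
    (M.isOpen_ball a _).mem_nhds
      (show M.d a a < _ by rwa [(M.d_eq_zero_iff a a).mpr rfl])
  obtain ⟨m, hm, hma⟩ := frequently_atTop.mp (ha.frequently hball) N
  obtain ⟨hmδ, hmε⟩ := lt_min_iff.mp (show M.d a (u m) < min δ _ from hma)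
  refine ⟨N, fun n hn => ?_⟩
  rw [Real.dist_0_eq_abs, abs_of_nonneg (M.d_nonneg _ _)]
  have hphi := h (u n) a (u m) (.inr hmδ)
  linarith [M.d_triangle (u n) a (u m), hN n hn m hm, M.d_symm a (u m)]

end PhiMetric

/-- every compact φ-metric space is complete. -/
theorem phiMetric_compact_complete {X : Type*} [Nonempty X] (M : PhiMetric X)
    (hcompact : @CompactSpace X M.toTopology) : M.Complete := by
  let _ := M.toTopology
  intro u hu
  obtain ⟨a, ha⟩ := exists_clusterPt_of_compactSpace (map u atTop)
  exact ⟨a, hu.tendsto_of_mapClusterPt ha⟩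
end

section
/- (Kannan-type contraction principle) Let (X, d_φ, φ) be a complete φ-metric space and let T : X → X satisfy d_φ(Tx, Ty) ≤ k · (d_φ(x, Tx) + d_φ(y, Ty)) for all x, y ∈ X, where k ∈ (0, 1/2). Then T has a unique fixed point in X. -/
open Filter Topology Set

namespace PhiMetric

variable {X : Type*}

/-- Successive iterates of a Kannan map become arbitrarily close. -/
theorem tendsto_d_iterate_succ (M : PhiMetric X) {T : X → X} {k : ℝ}
    (hk0 : 0 ≤ k) (hk1 : k < 1 / 2)
    (hT : ∀ x y : X, M.d (T x) (T y) ≤ k * (M.d x (T x) + M.d y (T y))) (x : X) :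
    Tendsto (fun n => M.d (T^[n] x) (T^[n + 1] x)) atTop (𝓝 0) := by
  have h1k : 0 < 1 - k := by linarith
  have hq0 : 0 ≤ k / (1 - k) := by positivity
  have hq1 : k / (1 - k) < 1 := by rw [div_lt_one h1k]; linarith
  have hbound (n : ℕ) :
      M.d (T^[n] x) (T^[n + 1] x) ≤ (k / (1 - k)) ^ n * M.d x (T x) := by
    induction n with
    | zero => simp
    | succ n ih =>
      have h := hT (T^[n] x) (T^[n + 1] x)
      simp only [← Function.iterate_succ_apply' T] at h
      have hstep : M.d (T^[n + 1] x) (T^[n + 1 + 1] x)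
          ≤ k / (1 - k) * M.d (T^[n] x) (T^[n + 1] x) := by
        rw [div_mul_eq_mul_div, le_div_iff₀ h1k]
        linarith
      calc _ ≤ _ := hstep
        _ ≤ k / (1 - k) * ((k / (1 - k)) ^ n * M.d x (T x)) := by gcongr
        _ = _ := by ring
  refine squeeze_zero (fun n => M.d_nonneg _ _) hbound ?_
  simpa using (tendsto_pow_atTop_nhds_zero_of_lt_one hq0 hq1).mul_const (M.d x (T x))

/-- The orbits of a Kannan map are Cauchy sequences. -/
theorem isCauchySeq_iterate (M : PhiMetric X) {T : X → X} {k : ℝ}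
    (hk0 : 0 ≤ k) (hk1 : k < 1 / 2)
    (hT : ∀ x y : X, M.d (T x) (T y) ≤ k * (M.d x (T x) + M.d y (T y))) (x : X) :
    M.IsCauchySeq (fun n => T^[n] x) := by
  intro ε hε
  obtain ⟨N, hN⟩ := eventually_atTop.1
    ((M.tendsto_d_iterate_succ hk0 hk1 hT x).eventually_lt_const hε)
  refine ⟨N + 1, fun m hm n hn => ?_⟩
  obtain ⟨m, rfl⟩ := Nat.exists_eq_add_of_le' (le_trans (Nat.le_add_left 1 N) hm)
  obtain ⟨n, rfl⟩ := Nat.exists_eq_add_of_le' (le_trans (Nat.le_add_left 1 N) hn)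
  have h := hT (T^[m] x) (T^[n] x)
  simp only [← Function.iterate_succ_apply' T] at h
  have hm' := hN m (by omega)
  have hn' := hN n (by omega)
  calc _ ≤ _ := h
    _ ≤ k * (ε + ε) := by gcongr
    _ < ε := by nlinarith

/-- If `u n` converges to `a`, then `phi y a (u n)` tends to `0`. -/
theorem tendsto_phi_of_tendsto_d (M : PhiMetric X) {u : ℕ → X} {a : X}
    (hu : Tendsto (fun n => M.d (u n) a) atTop (𝓝 0)) (y : X) :
    Tendsto (fun n => M.phi y a (u n)) atTop (𝓝 0) := by
  refine tendsto_order.2 ⟨fun b hb => .of_forall fun n => hb.trans_le (M.phi_nonneg _ _ _),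
    fun ε hε => ?_⟩
  obtain ⟨δ, hδ, h⟩ := M.phi_small ε hε
  filter_upwards [hu.eventually_lt_const hδ] with n hn
  exact h _ _ _ (Or.inr (by rwa [M.d_symm]))

end PhiMetric

/-- Kannan-type contraction principle. -/
theorem phiMetric_kannan {X : Type*} [Nonempty X] (M : PhiMetric X)
    (hX : M.Complete) (T : X → X) (k : ℝ) (hk0 : 0 < k) (hk1 : k < 1 / 2)
    (hT : ∀ x y : X, M.d (T x) (T y) ≤ k * (M.d x (T x) + M.d y (T y))) :
    ∃! z : X, T z = z := by
  obtain ⟨x⟩ := ‹Nonempty X›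
  obtain ⟨a, ha⟩ := hX _ (M.isCauchySeq_iterate hk0.le hk1 hT x)
  have hfix : T a = a := by
    have hle (n : ℕ) : M.d (T a) a ≤ k * (M.d a (T a) + M.d (T^[n] x) (T^[n + 1] x))
        + M.d (T^[n + 1] x) a + M.phi (T a) a (T^[n + 1] x) := by
      have h := hT a (T^[n] x)
      simp only [← Function.iterate_succ_apply' T] at h
      linarith [M.d_triangle (T a) a (T^[n + 1] x)]
    have hlim := ge_of_tendsto' ((((M.tendsto_d_iterate_succ hk0.le hk1 hT x).const_add
      (M.d a (T a))).const_mul k |>.add (ha.comp (tendsto_add_atTop_nat 1))).add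
      ((M.tendsto_phi_of_tendsto_d ha (T a)).comp (tendsto_add_atTop_nat 1))) hle
    rw [M.d_symm a] at hlim
    rw [← M.d_eq_zero_iff]
    nlinarith [M.d_nonneg (T a) a]
  refine ⟨a, hfix, fun b (hb : T b = b) => ?_⟩
  have h := hT b a
  rw [hb, hfix, (M.d_eq_zero_iff b b).2 rfl, (M.d_eq_zero_iff a a).2 rfl] at h
  rw [← M.d_eq_zero_iff]
  linarith [M.d_nonneg b a]
end
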